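/- Let ρ be the Dickman function and let 0 ≤ v < 1. Then for every real u ≥ 1, 0 ≤ ρ(u) − μ^{(1)}(u,v) ≤ v/Γ(u+1), where Γ is the Gamma function. -/

import Mathlib

open MeasureTheory

/-- The region `V_k(u,v)`. -/
def Vk (k : ℕ) (u v : ℝ) : Set (Fin k → ℝ) :=
  {t | (∀ i, t i ∈ Set.Ioo (0:ℝ) 1) ∧
    (∑ i ∈ Finset.univ.filter (fun i : Fin k => (i : ℕ) < k - 1), t i) < u - 1 ∧
    u - 1 < ∑ i, t i ∧ ∑ i, t i < u - v}

/-- The function `μ_k(u,v)`. -/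
noncomputable def muk (k : ℕ) (u v : ℝ) : ℝ :=
  if k = 1 then
    u⁻¹ * (volume (Set.Ioo (0:ℝ) 1 ∩ Set.Ioo (u-1) (u-v))).toReal
  else
    u⁻¹ * ∫ t in Vk k u v,
      ∏ j ∈ Finset.univ.filter (fun j : Fin k => (j : ℕ) < k - 1),
        (u - ∑ i ∈ Finset.univ.filter (fun i : Fin k => i ≤ j), t i)⁻¹

/-- `μ^{(κ)}(u,v) = ∑_{k ≥ 1} κ^k μ_k(u,v)`. -/
noncomputable def mukappa (κ u v : ℝ) : ℝ := ∑' k : ℕ, κ ^ (k+1) * muk (k+1) u v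

/-- The integrand of `muk`. -/
noncomputable def mukWeight (k : ℕ) (u : ℝ) (t : Fin k → ℝ) : ℝ :=
  ∏ j ∈ Finset.univ.filter (fun j : Fin k => (j : ℕ) < k - 1),
    (u - ∑ i ∈ Finset.univ.filter (fun i : Fin k => i ≤ j), t i)⁻¹

lemma measurable_mukWeight (k : ℕ) (u : ℝ) : Measurable (mukWeight k u) := by
  unfold mukWeight
  fun_prop

lemma measurableSet_Vk (k : ℕ) (u v : ℝ) : MeasurableSet (Vk k u v) := by
  have hsum : ∀ s : Finset (Fin k), Measurable fun t : Fin k → ℝ => ∑ i ∈ s, t i := by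
    intro s
    fun_prop
  have hset : Vk k u v = (Set.univ.pi fun _ => Set.Ioo (0:ℝ) 1) ∩
      ({t | (∑ i ∈ Finset.univ.filter (fun i : Fin k => (i : ℕ) < k - 1), t i) < u - 1} ∩
        ({t | u - 1 < ∑ i, t i} ∩ {t | ∑ i, t i < u - v})) := by
    ext t
    simp [Vk]
  rw [hset]
  exact (MeasurableSet.univ_pi fun _ => measurableSet_Ioo).inter
    ((measurableSet_lt (hsum _) measurable_const).inter
      ((measurableSet_lt measurable_const (hsum _)).inter
        (measurableSet_lt (hsum _) measurable_const)))

lemma volume_Vk_lt_top (k : ℕ) (u v : ℝ) : volume (Vk k u v) < ⊤ := by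
  have hsub : Vk k u v ⊆ Set.univ.pi fun _ => Set.Ioo (0:ℝ) 1 := fun t ht i _ => ht.1 i
  refine (measure_mono hsub).trans_lt ?_
  rw [volume_pi_pi]
  simp

/-- Every factor of the integrand of `muk` has denominator greater than one on `Vk`. -/
lemma one_lt_sub_sum_of_mem_Vk {k : ℕ} {u v : ℝ} {t : Fin k → ℝ} (ht : t ∈ Vk k u v)
    {j : Fin k} (hj : (j : ℕ) < k - 1) :
    1 < u - ∑ i ∈ Finset.univ.filter (fun i : Fin k => i ≤ j), t i := by
  have hle : ∑ i ∈ Finset.univ.filter (fun i : Fin k => i ≤ j), t i ≤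
      ∑ i ∈ Finset.univ.filter (fun i : Fin k => (i : ℕ) < k - 1), t i := by
    apply Finset.sum_le_sum_of_subset_of_nonneg
    · intro i hi
      simp only [Finset.mem_filter, Finset.mem_univ, true_and, Fin.le_def] at hi ⊢
      omega
    · intro i _ _
      exact (ht.1 i).1.le
  linarith [ht.2.1]

lemma mukWeight_nonneg {k : ℕ} {u v : ℝ} {t : Fin k → ℝ} (ht : t ∈ Vk k u v) :
    0 ≤ mukWeight k u t := by
  refine Finset.prod_nonneg fun j hj => inv_nonneg.2 ?_
  linarith [one_lt_sub_sum_of_mem_Vk ht (Finset.mem_filter.1 hj).2]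

lemma mukWeight_le_one {k : ℕ} {u v : ℝ} {t : Fin k → ℝ} (ht : t ∈ Vk k u v) :
    mukWeight k u t ≤ 1 := by
  refine Finset.prod_le_one (fun j hj => inv_nonneg.2 ?_) fun j hj => inv_le_one_of_one_le₀ ?_ <;>
  linarith [one_lt_sub_sum_of_mem_Vk ht (Finset.mem_filter.1 hj).2]

lemma integrable_indicator_mukWeight (k : ℕ) (u v : ℝ) :
    Integrable ((Vk k u v).indicator (mukWeight k u)) := by
  rw [integrable_indicator_iff (measurableSet_Vk k u v)]
  refine Measure.integrableOn_of_bounded (M := 1) (volume_Vk_lt_top k u v).ne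
    (measurable_mukWeight k u).aestronglyMeasurable ?_
  refine (ae_restrict_iff' (measurableSet_Vk k u v)).2 (Filter.Eventually.of_forall fun t ht => ?_)
  rw [Real.norm_of_nonneg (mukWeight_nonneg ht)]
  exact mukWeight_le_one ht

lemma muk_eq_integral_indicator {k : ℕ} (hk : 1 ≤ k) {u v : ℝ} (hu : k = 1 → 1 < u) :
    muk k u v = u⁻¹ * ∫ t, (Vk k u v).indicator (mukWeight k u) t := by
  rw [integral_indicator (measurableSet_Vk k u v)]
  unfold muk
  split_ifs with h
  · subst h
    congr 1
    have hset : Vk 1 u v = MeasurableEquiv.funUnique (Fin 1) ℝ ⁻¹'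
        (Set.Ioo (0:ℝ) 1 ∩ Set.Ioo (u-1) (u-v)) := by
      ext t
      simp [Vk, hu rfl]
    have hw : mukWeight 1 u = fun _ => 1 := by
      ext t
      simp [mukWeight]
    rw [hw, setIntegral_const, hset, measureReal_def, smul_eq_mul, mul_one]
    exact congrArg ENNReal.toReal
      ((volume_preserving_funUnique (Fin 1) ℝ).measure_preimage_equiv _).symm
  · rfl

lemma muk_nonneg (k : ℕ) {u v : ℝ} (hu : 0 ≤ u) : 0 ≤ muk k u v := by
  unfold muk
  split_ifs
  · positivity
  · exact mul_nonneg (inv_nonneg.2 hu)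
      (setIntegral_nonneg (measurableSet_Vk k u v) fun t ht => mukWeight_nonneg ht)

lemma cons_mem_Vk_iff {k : ℕ} (u v x : ℝ) (s : Fin (k + 1) → ℝ) :
    (Fin.cons x s : Fin (k + 2) → ℝ) ∈ Vk (k + 2) u v ↔
      x ∈ Set.Ioo 0 (min 1 (u - 1)) ∧ s ∈ Vk (k + 1) (u - x) v := by
  simp only [Vk, Set.mem_ofPred_eq, Fin.forall_fin_succ (n := k + 1), Fin.cons_zero, Fin.cons_succ,
    Finset.sum_filter, Fin.sum_univ_succ (n := k + 1), Fin.val_zero, Fin.val_succ, Set.mem_Ioo,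
    lt_min_iff, Nat.add_sub_cancel, show k + 2 - 1 = k + 1 from rfl, add_lt_add_iff_right]
  constructor
  · rintro ⟨⟨hx, hs⟩, h1, h2, h3⟩
    have hnn : 0 ≤ ∑ i : Fin (k + 1), if (i : ℕ) < k then s i else 0 :=
      Finset.sum_nonneg fun i _ => by
        split_ifs
        · exact (hs i).1.le
        · exact le_rfl
    simp only [Nat.zero_lt_succ, if_true] at h1
    exact ⟨⟨hx.1, hx.2, by linarith⟩, hs, by linarith, by linarith, by linarith⟩
  · rintro ⟨⟨hx0, hx1, -⟩, hs, h1, h2, h3⟩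
    simp only [Nat.zero_lt_succ, if_true]
    exact ⟨⟨⟨hx0, hx1⟩, hs⟩, by linarith, by linarith, by linarith⟩

lemma mukWeight_cons {k : ℕ} (u x : ℝ) (s : Fin (k + 1) → ℝ) :
    mukWeight (k + 2) u (Fin.cons x s) = (u - x)⁻¹ * mukWeight (k + 1) (u - x) s := by
  simp [mukWeight, Finset.prod_filter, Finset.sum_filter, Fin.prod_univ_succ (n := k + 1),
    Fin.sum_univ_succ (n := k + 1), sub_sub, mul_comm]

lemma integrable_and_integral_cons {k : ℕ} {F : (Fin (k + 1) → ℝ) → ℝ} (hF : Integrable F) :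
    Integrable (fun x : ℝ => ∫ s : Fin k → ℝ, F (Fin.cons x s)) ∧
      ∫ t, F t = ∫ x : ℝ, ∫ s : Fin k → ℝ, F (Fin.cons x s) := by
  have hmp := (volume_preserving_piFinSuccAbove (fun _ : Fin (k + 1) => ℝ) 0).symm
  have hint := (hmp.integrable_comp_emb (MeasurableEquiv.measurableEmbedding _)).2 hF
  have hcons : F ∘ (MeasurableEquiv.piFinSuccAbove (fun _ : Fin (k + 1) => ℝ) 0).symm =
      fun p : ℝ × (Fin k → ℝ) => F (Fin.cons p.1 p.2) := by
    ext p
    simp [MeasurableEquiv.piFinSuccAbove, Fin.insertNthEquiv]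
  rw [hcons] at hint
  have heq : ∫ p : ℝ × (Fin k → ℝ), F (Fin.cons p.1 p.2) = ∫ t, F t := by
    rw [← hmp.integral_comp' F]
    exact congrArg (fun g => ∫ p, g p) hcons.symm
  rw [← heq]
  exact ⟨hint.integral_prod_left, integral_prod _ hint⟩

/-- Splitting off the first variable in `muk`. -/
lemma integral_indicator_cons (k : ℕ) (u v x : ℝ) :
    ∫ s : Fin (k + 1) → ℝ, (Vk (k + 2) u v).indicator (mukWeight (k + 2) u) (Fin.cons x s) =
      (Set.Ioo 0 (min 1 (u - 1))).indicator (fun x => muk (k + 1) (u - x) v) x := by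
  by_cases hx : x ∈ Set.Ioo 0 (min 1 (u - 1))
  · rw [Set.indicator_of_mem hx, muk_eq_integral_indicator (by omega)
      (fun _ => by linarith [hx.2.trans_le (min_le_right _ _)]), ← integral_const_mul]
    congr 1 with s
    by_cases hs : s ∈ Vk (k + 1) (u - x) v
    · rw [Set.indicator_of_mem hs, Set.indicator_of_mem ((cons_mem_Vk_iff u v x s).2 ⟨hx, hs⟩),
        mukWeight_cons]
    · rw [Set.indicator_of_notMem hs, mul_zero,
        Set.indicator_of_notMem fun h => hs ((cons_mem_Vk_iff u v x s).1 h).2]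
  · rw [Set.indicator_of_notMem hx]
    simp_rw [fun s : Fin (k + 1) → ℝ => Set.indicator_of_notMem
      (fun h => hx ((cons_mem_Vk_iff u v x s).1 h).1) (mukWeight (k + 2) u)]
    simp

lemma integrableOn_muk_sub (k : ℕ) (u v : ℝ) :
    IntegrableOn (fun x => muk (k + 1) (u - x) v) (Set.Ioo 0 (min 1 (u - 1))) := by
  have h := (integrable_and_integral_cons (integrable_indicator_mukWeight (k + 2) u v)).1
  simp_rw [integral_indicator_cons] at h
  exact (integrable_indicator_iff measurableSet_Ioo).1 h

lemma muk_add_two (k : ℕ) (u v : ℝ) :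
    muk (k + 2) u v = u⁻¹ * ∫ x in Set.Ioo 0 (min 1 (u - 1)), muk (k + 1) (u - x) v := by
  rw [muk_eq_integral_indicator (by omega) (by omega),
    (integrable_and_integral_cons (integrable_indicator_mukWeight (k + 2) u v)).2]
  simp_rw [integral_indicator_cons]
  rw [integral_indicator measurableSet_Ioo]

lemma muk_one_eq {u v : ℝ} (hu : 1 ≤ u) :
    muk 1 u v = u⁻¹ * max (min 1 (u - v) - (u - 1)) 0 := by
  rw [muk, if_pos rfl, Set.Ioo_inter_Ioo, Real.volume_Ioo, ENNReal.toReal_ofReal',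
    sup_eq_right.2 (by linarith : (0:ℝ) ≤ u - 1)]

lemma sum_muk_succ (n : ℕ) {u : ℝ} (hu : 1 ≤ u) (v : ℝ) :
    u * ∑ k ∈ Finset.range (n + 1), muk (k + 1) u v = max (min 1 (u - v) - (u - 1)) 0 +
      ∫ x in Set.Ioo 0 (min 1 (u - 1)), ∑ k ∈ Finset.range n, muk (k + 1) (u - x) v := by
  rw [integral_finsetSum _ fun k _ => integrableOn_muk_sub k u v, Finset.sum_range_succ', mul_add,
    Finset.mul_sum, muk_one_eq hu, mul_inv_cancel_left₀ (by positivity), add_comm]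
  congr 1
  refine Finset.sum_congr rfl fun k _ => ?_
  rw [muk_add_two, mul_inv_cancel_left₀ (by positivity)]

lemma one_le_Gamma {s : ℝ} (hs : 2 ≤ s) : 1 ≤ Real.Gamma s := by
  have h := Real.Gamma_strictMonoOn_Ici.monotoneOn Set.self_mem_Ici hs hs
  rwa [Real.Gamma_two] at h

lemma Gamma_le_one {s : ℝ} (hs1 : 1 ≤ s) (hs2 : s ≤ 2) : Real.Gamma s ≤ 1 := by
  have h := Real.convexOn_Gamma.2 (show (1:ℝ) ∈ Set.Ioi 0 by simp) (show (2:ℝ) ∈ Set.Ioi 0 by simp)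
    (sub_nonneg.2 hs2) (sub_nonneg.2 hs1) (by ring)
  simp only [smul_eq_mul, Real.Gamma_one, Real.Gamma_two] at h
  rw [show (2 - s) * 1 + (s - 1) * 2 = s by ring] at h
  linarith

/-- The integral equation `u ρ(u) = ∫_{u-1}^u ρ`. -/
lemma dickman_mul_eq_integral {ρ : ℝ → ℝ} (hρcont : ContinuousOn ρ (Set.Ici (0:ℝ)))
    (hρ1 : ∀ t : ℝ, 0 ≤ t → t ≤ 1 → ρ t = 1)
    (hρderiv : ∀ t : ℝ, 1 < t → HasDerivAt ρ (-(ρ (t - 1)) / t) t) {u : ℝ} (hu : 1 ≤ u) :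
    u * ρ u = ∫ x in (u - 1)..u, ρ x := by
  set r : ℝ → ℝ := fun x => ρ (max x 0) with hr
  have hrρ : ∀ x, 0 ≤ x → r x = ρ x := fun x hx => by simp [hr, hx]
  have hrcont : Continuous r :=
    hρcont.comp_continuous (by fun_prop) fun x => le_max_right x 0
  have hone : ∫ x in (0:ℝ)..1, r x = 1 := by
    rw [intervalIntegral.integral_congr (g := fun _ => 1)]
    · simp
    · intro x hx
      rw [Set.uIcc_of_le zero_le_one] at hx
      exact (hrρ x hx.1).trans (hρ1 x hx.1 hx.2)
  let P : ℝ → ℝ := fun y => ∫ x in (0:ℝ)..y, r x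
  have hP : ∀ y, HasDerivAt P (r y) y := fun y =>
    intervalIntegral.integral_hasDerivAt_right (hrcont.intervalIntegrable _ _)
      hrcont.stronglyMeasurable.stronglyMeasurableAtFilter hrcont.continuousAt
  have hPcont : Continuous P := continuous_iff_continuousAt.2 fun y => (hP y).continuousAt
  let G : ℝ → ℝ := fun y => y * r y - (P y - P (y - 1))
  have hG : ∀ y, 1 < y → HasDerivAt G 0 y := fun y hy => by
    have hry : HasDerivAt r (-(ρ (y - 1)) / y) y := by
      refine (hρderiv y hy).congr_of_eventuallyEq ?_
      filter_upwards [lt_mem_nhds (zero_lt_one.trans hy)] with x hx using hrρ x hx.le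
    have h := ((hasDerivAt_id y).mul hry).sub
      ((hP y).sub ((hP (y - 1)).comp_sub_const y 1))
    refine h.congr_deriv ?_
    rw [hrρ y (by linarith), hrρ (y - 1) (by linarith)]
    have : y ≠ 0 := by positivity
    simp only [id]
    field_simp
    ring
  have hGu : G u = G 1 := by
    rcases hu.eq_or_lt with rfl | hlt
    · rfl
    · obtain ⟨c, -, hc⟩ := exists_hasDerivAt_eq_slope G (fun _ => 0) hlt
        (by fun_prop) fun y hy => hG y hy.1
      rcases div_eq_zero_iff.1 hc.symm with h | h <;> linarith
  have hG1 : G 1 = 0 := by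
    simp [G, P, hone, hrρ 1 zero_le_one, hρ1 1 zero_le_one le_rfl]
  have hdiff : P u - P (u - 1) = ∫ x in (u - 1)..u, r x :=
    intervalIntegral.integral_interval_sub_left (hrcont.intervalIntegrable _ _)
      (hrcont.intervalIntegrable _ _)
  have hcongr : ∫ x in (u - 1)..u, r x = ∫ x in (u - 1)..u, ρ x := by
    refine intervalIntegral.integral_congr fun x hx => hrρ x ?_
    rw [Set.uIcc_of_le (by linarith)] at hx
    linarith [hx.1]
  rw [← hcongr, ← hdiff, ← hrρ u (by linarith)]
  have : G u = 0 := hGu.trans hG1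
  exact sub_eq_zero.1 this

lemma dickman_nonneg {ρ : ℝ → ℝ} (hρcont : ContinuousOn ρ (Set.Ici (0:ℝ)))
    (hρ1 : ∀ t : ℝ, 0 ≤ t → t ≤ 1 → ρ t = 1)
    (hρderiv : ∀ t : ℝ, 1 < t → HasDerivAt ρ (-(ρ (t - 1)) / t) t) {u : ℝ} (hu : 0 ≤ u) :
    0 ≤ ρ u := by
  obtain ⟨w, hw, hmin⟩ := isCompact_Icc.exists_isMinOn (Set.nonempty_Icc.2 hu)
    (hρcont.mono fun x hx => hx.1)
  refine le_trans ?_ (hmin (Set.right_mem_Icc.2 hu))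
  rcases le_or_gt w 1 with hw1 | hw1
  · rw [hρ1 w hw.1 hw1]
    exact zero_le_one
  · have hint : IntervalIntegrable ρ volume (w - 1) w := by
      refine (hρcont.mono fun x hx => ?_).intervalIntegrable
      rw [Set.uIcc_of_le (by linarith)] at hx
      exact le_trans (by linarith) hx.1
    have h : ∫ _ in (w - 1)..w, ρ w ≤ ∫ x in (w - 1)..w, ρ x :=
      intervalIntegral.integral_mono_on (by linarith) (by simp) hint fun x hx =>
        hmin ⟨by linarith [hx.1], hx.2.trans hw.2⟩
    rw [← dickman_mul_eq_integral hρcont hρ1 hρderiv hw1.le] at h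
    simp only [intervalIntegral.integral_const, smul_eq_mul] at h
    nlinarith

lemma integrableOn_dickman_sub {ρ : ℝ → ℝ} (hρcont : ContinuousOn ρ (Set.Ici (0:ℝ))) (u : ℝ) :
    IntegrableOn (fun x => ρ (u - x)) (Set.Ioo 0 (min 1 (u - 1))) := by
  refine (ContinuousOn.integrableOn_Icc (hρcont.comp (by fun_prop) fun x hx => ?_)).mono_set
    Set.Ioo_subset_Icc_self
  have := hx.2.trans (min_le_right _ _)
  simp only [Set.mem_Ici]
  linarith

lemma dickman_mul_eq {ρ : ℝ → ℝ} (hρcont : ContinuousOn ρ (Set.Ici (0:ℝ)))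
    (hρ1 : ∀ t : ℝ, 0 ≤ t → t ≤ 1 → ρ t = 1)
    (hρderiv : ∀ t : ℝ, 1 < t → HasDerivAt ρ (-(ρ (t - 1)) / t) t) {u : ℝ} (hu : 1 ≤ u) :
    u * ρ u = (1 - min 1 (u - 1)) + ∫ x in Set.Ioo 0 (min 1 (u - 1)), ρ (u - x) := by
  set m := min 1 (u - 1) with hm
  have hm0 : 0 ≤ m := le_min zero_le_one (by linarith)
  have hm1 : m ≤ 1 := min_le_left _ _
  have hmu : m ≤ u - 1 := min_le_right _ _
  have hcont : ContinuousOn (fun x => ρ (u - x)) (Set.Icc 0 1) :=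
    hρcont.comp (by fun_prop) fun x hx => by
      simp only [Set.mem_Ici]
      linarith [hx.2]
  have hsub : ∫ x in (u - 1)..u, ρ x = ∫ x in (0:ℝ)..1, ρ (u - x) := by
    rw [intervalIntegral.integral_comp_sub_left, sub_zero]
  have hright : ∫ x in m..1, ρ (u - x) = 1 - m := by
    rcases min_choice 1 (u - 1) with h | h
    · simp [hm.trans h]
    · rw [intervalIntegral.integral_congr (g := fun _ => 1)]
      · simp
      · intro x hx
        rw [Set.uIcc_of_le hm1] at hx
        exact hρ1 _ (by linarith [hx.2]) (by linarith [hx.1, hm.trans h])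
  rw [dickman_mul_eq_integral hρcont hρ1 hρderiv hu, hsub,
    ← intervalIntegral.integral_add_adjacent_intervals (b := m), hright,
    intervalIntegral.integral_of_le hm0, integral_Ioc_eq_integral_Ioo, add_comm]
  · refine (hcont.mono ?_).intervalIntegrable
    rw [Set.uIcc_of_le hm0]
    exact Set.Icc_subset_Icc_right hm1
  · refine (hcont.mono ?_).intervalIntegrable
    rw [Set.uIcc_of_le hm1]
    exact Set.Icc_subset_Icc_left hm0

/-- The recursion for the difference of the Dickman function and the partial sums of `mukappa`. -/
lemma dickman_sub_sum_muk_succ {ρ : ℝ → ℝ} (hρcont : ContinuousOn ρ (Set.Ici (0:ℝ)))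
    (hρ1 : ∀ t : ℝ, 0 ≤ t → t ≤ 1 → ρ t = 1)
    (hρderiv : ∀ t : ℝ, 1 < t → HasDerivAt ρ (-(ρ (t - 1)) / t) t) {u : ℝ} (hu : 1 ≤ u)
    (v : ℝ) (n : ℕ) :
    u * (ρ u - ∑ k ∈ Finset.range (n + 1), muk (k + 1) u v) =
      (1 - min 1 (u - 1)) - max (min 1 (u - v) - (u - 1)) 0 +
        ∫ x in Set.Ioo 0 (min 1 (u - 1)),
          (ρ (u - x) - ∑ k ∈ Finset.range n, muk (k + 1) (u - x) v) := by
  rw [integral_sub (integrableOn_dickman_sub hρcont u)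
    (integrable_finsetSum _ fun k _ => integrableOn_muk_sub k u v), mul_sub,
    dickman_mul_eq hρcont hρ1 hρderiv hu, sum_muk_succ n hu v]
  ring

lemma sum_muk_le_dickman {ρ : ℝ → ℝ} (hρcont : ContinuousOn ρ (Set.Ici (0:ℝ)))
    (hρ1 : ∀ t : ℝ, 0 ≤ t → t ≤ 1 → ρ t = 1)
    (hρderiv : ∀ t : ℝ, 1 < t → HasDerivAt ρ (-(ρ (t - 1)) / t) t) (v : ℝ)
    (n : ℕ) : ∀ u : ℝ, 1 ≤ u → ∑ k ∈ Finset.range n, muk (k + 1) u v ≤ ρ u := by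
  induction n with
  | zero =>
    intro u hu
    simpa using dickman_nonneg hρcont hρ1 hρderiv (zero_le_one.trans hu)
  | succ n ih =>
    intro u hu
    have hrec := dickman_sub_sum_muk_succ hρcont hρ1 hρderiv hu v n
    have hint : 0 ≤ ∫ x in Set.Ioo 0 (min 1 (u - 1)),
        (ρ (u - x) - ∑ k ∈ Finset.range n, muk (k + 1) (u - x) v) :=
      setIntegral_nonneg measurableSet_Ioo fun x hx =>
        sub_nonneg.2 (ih _ (by linarith [hx.2.trans_le (min_le_right _ _)]))
    have hconst : max (min 1 (u - v) - (u - 1)) 0 ≤ 1 - min 1 (u - 1) := by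
      refine max_le ?_ (sub_nonneg.2 (min_le_left _ _))
      linarith [min_le_left 1 (u - v), min_le_right 1 (u - 1)]
    have hpos : 0 ≤ u * (ρ u - ∑ k ∈ Finset.range (n + 1), muk (k + 1) u v) := by
      rw [hrec]
      linarith
    exact sub_nonneg.1 (nonneg_of_mul_nonneg_right hpos (by linarith))

/-- The function `v / Γ(u + 1)` is a supersolution of the limiting integral equation. -/
lemma exists_bound_div_Gamma {u v : ℝ} (hu : 1 ≤ u) (hv0 : 0 ≤ v) (hv : v < 1) :
    ∃ B : ℝ, (∀ x ∈ Set.Ioo 0 (min 1 (u - 1)), v / Real.Gamma (u - x + 1) ≤ B) ∧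
      (1 - min 1 (u - 1)) - max (min 1 (u - v) - (u - 1)) 0 + min 1 (u - 1) * B ≤
        u * (v / Real.Gamma (u + 1)) := by
  have hΓ : u * (v / Real.Gamma (u + 1)) = v / Real.Gamma u := by
    have hu0 : u ≠ 0 := by positivity
    rw [Real.Gamma_add_one hu0]
    field_simp
  have hΓpos : 0 < Real.Gamma u := Real.Gamma_pos_of_pos (by linarith)
  rw [hΓ]
  rcases le_total u 2 with h2 | h2
  · refine ⟨v, fun x hx => div_le_self hv0 (one_le_Gamma ?_), ?_⟩
    · linarith [hx.2.trans_le (min_le_right _ _)]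
    · rw [min_eq_right (by linarith : u - 1 ≤ 1)]
      refine le_trans ?_ (le_div_self hv0 hΓpos (Gamma_le_one hu h2))
      rcases le_total (u - v) 1 with h | h
      · rw [min_eq_right h]
        nlinarith [le_max_left (u - v - (u - 1)) 0]
      · rw [min_eq_left h]
        nlinarith [le_max_left (1 - (u - 1)) 0]
  · rw [min_eq_left (by linarith : 1 ≤ u - 1)]
    refine ⟨v / Real.Gamma u, fun x hx => ?_, by linarith [le_max_right (min 1 (u - v) - (u - 1)) 0]⟩
    refine div_le_div_of_nonneg_left hv0 hΓpos ?_
    exact Real.Gamma_strictMonoOn_Ici.monotoneOn h2 (Set.mem_Ici.2 (by linarith [hx.2]))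
      (by linarith [hx.2])

lemma dickman_sub_sum_muk_le {ρ : ℝ → ℝ} (hρcont : ContinuousOn ρ (Set.Ici (0:ℝ)))
    (hρ1 : ∀ t : ℝ, 0 ≤ t → t ≤ 1 → ρ t = 1)
    (hρderiv : ∀ t : ℝ, 1 < t → HasDerivAt ρ (-(ρ (t - 1)) / t) t) {v : ℝ} (hv0 : 0 ≤ v)
    (hv : v < 1) {U C : ℝ} (hC : ∀ u ∈ Set.Icc 1 U, ρ u ≤ C) (hC0 : 0 ≤ C) (n : ℕ) :
    ∀ u ∈ Set.Icc 1 U, ρ u - ∑ k ∈ Finset.range n, muk (k + 1) u v ≤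
      v / Real.Gamma (u + 1) + C * (1 - U⁻¹) ^ n := by
  induction n with
  | zero =>
    intro u hu
    have : 0 ≤ v / Real.Gamma (u + 1) :=
      div_nonneg hv0 (Real.Gamma_pos_of_pos (by linarith [hu.1])).le
    simpa using (hC u hu).trans (by linarith)
  | succ n ih =>
    intro u hu
    have hu0 : 0 < u := zero_lt_one.trans_le hu.1
    have hrec := dickman_sub_sum_muk_succ hρcont hρ1 hρderiv hu.1 v n
    obtain ⟨B, hB, hBle⟩ := exists_bound_div_Gamma hu.1 hv0 hv
    set m := min 1 (u - 1) with hm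
    have hm0 : 0 ≤ m := le_min zero_le_one (by linarith [hu.1])
    have hmu : m ≤ u - 1 := min_le_right _ _
    set q := 1 - U⁻¹ with hq
    have hU : U⁻¹ ≤ u⁻¹ := inv_anti₀ hu0 hu.2
    have hU1 : u⁻¹ ≤ 1 := inv_le_one_of_one_le₀ hu.1
    have hq0 : 0 ≤ q := by linarith
    have hint : ∫ x in Set.Ioo 0 m, (ρ (u - x) - ∑ k ∈ Finset.range n, muk (k + 1) (u - x) v) ≤
        ∫ _ in Set.Ioo 0 m, (B + C * q ^ n) := by
      refine setIntegral_mono_on ((integrableOn_dickman_sub hρcont u).sub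
        (integrable_finsetSum _ fun k _ => integrableOn_muk_sub k u v)) (by simp)
        measurableSet_Ioo fun x hx => ?_
      refine (ih (u - x) ⟨by linarith [hx.2], by linarith [hx.1, hu.2]⟩).trans ?_
      linarith [hB x hx]
    rw [setIntegral_const, Real.volume_real_Ioo_of_le hm0, smul_eq_mul, sub_zero] at hint
    have hcontr : m * (C * q ^ n) ≤ u * (C * q ^ (n + 1)) := by
      have h1 : u - 1 ≤ u * q := by
        have : u * u⁻¹ = 1 := mul_inv_cancel₀ hu0.ne'
        nlinarith
      calc m * (C * q ^ n) ≤ (u * q) * (C * q ^ n) :=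
            mul_le_mul_of_nonneg_right (hmu.trans h1) (by positivity)
        _ = u * (C * q ^ (n + 1)) := by ring
    refine le_of_mul_le_mul_left ?_ hu0
    rw [hrec, mul_add]
    linarith

/-- Comparison of the Dickman function with `μ^{(1)}` (Proposition 3.4, (3.9)). -/
theorem dickman_sub_mukappa_le (ρ : ℝ → ℝ)
    (hρcont : ContinuousOn ρ (Set.Ici (0:ℝ)))
    (hρ1 : ∀ t : ℝ, 0 ≤ t → t ≤ 1 → ρ t = 1)
    (hρderiv : ∀ t : ℝ, 1 < t → HasDerivAt ρ (-(ρ (t - 1)) / t) t)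
    (v : ℝ) (hv0 : 0 ≤ v) (hv : v < 1) :
    ∀ u : ℝ, 1 ≤ u →
      0 ≤ ρ u - mukappa 1 u v ∧ ρ u - mukappa 1 u v ≤ v / Real.Gamma (u + 1) := by
  intro u hu
  have hnn : ∀ k, 0 ≤ muk (k + 1) u v := fun k => muk_nonneg _ (by linarith)
  have hle : ∀ n, ∑ k ∈ Finset.range n, muk (k + 1) u v ≤ ρ u := fun n =>
    sum_muk_le_dickman hρcont hρ1 hρderiv v n u hu
  have hmu : mukappa 1 u v = ∑' k : ℕ, muk (k + 1) u v := by simp [mukappa]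
  have hlim := (summable_of_sum_range_le hnn hle).hasSum.tendsto_sum_nat
  rw [← hmu] at hlim
  refine ⟨sub_nonneg.2 (le_of_tendsto' hlim hle), ?_⟩
  obtain ⟨C, hC⟩ := isCompact_Icc.bddAbove_image
    (hρcont.mono fun x (hx : x ∈ Set.Icc 1 u) => zero_le_one.trans hx.1)
  have hC' : ∀ w ∈ Set.Icc 1 u, ρ w ≤ C := fun w hw => hC (Set.mem_image_of_mem ρ hw)
  have hC0 : 0 ≤ C := by
    have h := hC' 1 ⟨le_rfl, hu⟩
    rw [hρ1 1 zero_le_one le_rfl] at h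
    linarith
  have hpow : Filter.Tendsto (fun n : ℕ => v / Real.Gamma (u + 1) + C * (1 - u⁻¹) ^ n)
      Filter.atTop (nhds (v / Real.Gamma (u + 1) + C * 0)) :=
    ((tendsto_pow_atTop_nhds_zero_of_lt_one (sub_nonneg.2 (inv_le_one_of_one_le₀ hu))
      (sub_lt_self 1 (inv_pos.2 (zero_lt_one.trans_le hu)))).const_mul C).const_add _
  rw [mul_zero, add_zero] at hpow
  exact le_of_tendsto_of_tendsto' (hlim.const_sub (ρ u)) hpow fun n =>
    dickman_sub_sum_muk_le hρcont hρ1 hρderiv hv0 hv hC' hC0 n u (Set.right_mem_Icc.2 hu)
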